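/- arXiv:1903.01156 — 7 statements merged into one kernel-verified Lean document; each statement's English description precedes it below -/
import Mathlib

section
/- Let E be a real inner product space and let P : E → E be a self-adjoint positive semidefinite linear map. Let Ω ⊆ E be open, let u, v : Ω → ℝ be differentiable at a point x ∈ Ω with v(x) ≠ 0. Then, writing ∇ for the gradient with respect to the inner product, one has the Picone-type identity 0 ≤ ⟨P(∇u(x) − (u(x)/v(x))·∇v(x)), ∇u(x) − (u(x)/v(x))·∇v(x)⟩ = ⟨P(∇u(x)), ∇u(x)⟩ − ⟨∇(u²/v)(x), P(∇v(x))⟩. -/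
open scoped RealInnerProductSpace

theorem HasGradientAt.sq_div {E : Type*} [NormedAddCommGroup E] [InnerProductSpace ℝ E]
    [CompleteSpace E] {u v : E → ℝ} {gu gv x : E}
    (hu : HasGradientAt u gu x) (hv : HasGradientAt v gv x) (hvx : v x ≠ 0) :
    HasGradientAt (fun y => (u y) ^ 2 / v y)
      ((2 * u x / v x) • gu - ((u x) ^ 2 / (v x) ^ 2) • gv) x := by
  rw [hasGradientAt_iff_hasFDerivAt] at *
  have hinv := (hasDerivAt_inv hvx).comp_hasFDerivAt x hv
  refine ((hu.pow 2).mul hinv).congr_fderiv ?_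
  ext y
  simp
  field_simp
  ring

/-- **Picone-type identity.** Let `E` be a real inner product space and `P : E → E` a
self-adjoint positive semidefinite linear map. Let `Ω ⊆ E` be open and `u, v : Ω → ℝ`
differentiable at `x ∈ Ω` (with gradients `gu`, `gv`) with `v x ≠ 0`. Then, with `gw` the
gradient of `u²/v` at `x`,
`0 ≤ ⟪P (gu − (u x / v x) • gv), gu − (u x / v x) • gv⟫`
duly equals `⟪P gu, gu⟫ − ⟪gw, P gv⟫`. -/
theorem picone_identity
    {E : Type*} [NormedAddCommGroup E] [InnerProductSpace ℝ E] [CompleteSpace E]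
    (P : E →ₗ[ℝ] E)
    (hP_selfadj : ∀ a b : E, ⟪P a, b⟫ = ⟪a, P b⟫)
    (hP_psd : ∀ a : E, 0 ≤ ⟪P a, a⟫)
    (Ω : Set E) (hΩ : IsOpen Ω) (u v : E → ℝ) (x : E) (hx : x ∈ Ω)
    (gu gv gw : E)
    (hu : HasGradientAt u gu x) (hv : HasGradientAt v gv x) (hvx : v x ≠ 0)
    (hw : HasGradientAt (fun y => (u y) ^ 2 / v y) gw x) :
    0 ≤ ⟪P (gu - (u x / v x) • gv), gu - (u x / v x) • gv⟫ ∧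
      ⟪P (gu - (u x / v x) • gv), gu - (u x / v x) • gv⟫
        = ⟪P gu, gu⟫ - ⟪gw, P gv⟫ := by
  refine ⟨hP_psd _, ?_⟩
  rw [hw.unique (hu.sq_div hv hvx)]
  have hvu : ⟪P gv, gu⟫ = ⟪gu, P gv⟫ := real_inner_comm _ _
  have hvv : ⟪P gv, gv⟫ = ⟪gv, P gv⟫ := real_inner_comm _ _
  simp only [map_sub, map_smul, inner_sub_left, inner_sub_right, real_inner_smul_left,
    real_inner_smul_right, hP_selfadj gu gv, hvu, hvv]
  ring
end

section
/- Let E be a finite-dimensional real inner product space, Ω ⊆ E a connected open set, and for each x ∈ Ω let P(x) : E → E be a self-adjoint positive definite linear map. Let u, v : Ω → ℝ be continuously differentiable with v > 0 on Ω. If ⟨P(x)(∇u(x) − (u(x)/v(x))·∇v(x)), ∇u(x) − (u(x)/v(x))·∇v(x)⟩ = 0 for every x ∈ Ω, then there exists a constant C ∈ ℝ such that u = C·v on Ω. -/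
open scoped RealInnerProductSpace

/-- If `Ω` is a connected open subset of a finite-dimensional real inner product space,
`P x` is a self-adjoint positive definite linear map for each `x ∈ Ω`, and `u, v` are `C¹`
functions on `Ω` with `v > 0`, such that
`⟪P x (∇u x − (u x / v x) • ∇v x), ∇u x − (u x / v x) • ∇v x⟫ = 0` on `Ω`,
then `u = C • v` on `Ω` for some constant `C`. -/
theorem picone_vanishing_implies_proportional
    {E : Type*} [NormedAddCommGroup E] [InnerProductSpace ℝ E] [FiniteDimensional ℝ E]
    (Ω : Set E) (hΩ_open : IsOpen Ω) (hΩ_conn : IsConnected Ω)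
    (P : E → E →ₗ[ℝ] E)
    (hP_selfadj : ∀ x ∈ Ω, ∀ a b : E, ⟪P x a, b⟫ = ⟪a, P x b⟫)
    (hP_pd : ∀ x ∈ Ω, ∀ a : E, a ≠ 0 → 0 < ⟪P x a, a⟫)
    (u v : E → ℝ)
    (hu : ContDiffOn ℝ 1 u Ω) (hv : ContDiffOn ℝ 1 v Ω)
    (hv_pos : ∀ x ∈ Ω, 0 < v x)
    (hzero : ∀ x ∈ Ω,
      ⟪P x (gradient u x - (u x / v x) • gradient v x),
        gradient u x - (u x / v x) • gradient v x⟫ = 0) :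
    ∃ C : ℝ, ∀ x ∈ Ω, u x = C * v x := by
  have hud : DifferentiableOn ℝ u Ω := hu.differentiableOn one_ne_zero
  have hvd : DifferentiableOn ℝ v Ω := hv.differentiableOn one_ne_zero
  have hgrad : ∀ x ∈ Ω, gradient u x = (u x / v x) • gradient v x := fun x hx ↦ by
    by_contra hne
    exact (hP_pd x hx _ (sub_ne_zero.mpr hne)).ne' (hzero x hx)
  have hquot : ∀ x ∈ Ω, HasFDerivAt (fun y ↦ u y * (v y)⁻¹) (0 : E →L[ℝ] ℝ) x := fun x hx ↦ by
    have hvx := (hv_pos x hx).ne'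
    have hnhds := hΩ_open.mem_nhds hx
    have hu' := (hud.hasGradientAt hnhds).hasFDerivAt
    have hv' := (hvd.hasGradientAt hnhds).hasFDerivAt
    rw [hgrad x hx] at hu'
    have hinv := (hasDerivAt_inv hvx).comp_hasFDerivAt x hv'
    refine (hu'.mul hinv).congr_fderiv ?_
    ext y
    simp
    field_simp
    ring
  obtain ⟨C, hC⟩ := hΩ_open.exists_is_const_of_fderiv_eq_zero hΩ_conn.isPreconnected
    (fun x hx ↦ (hquot x hx).differentiableAt.differentiableWithinAt)
    fun x hx ↦ (hquot x hx).fderiv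
  exact ⟨C, fun x hx ↦ (mul_inv_eq_iff_eq_mul₀ (hv_pos x hx).ne').mp (hC x hx)⟩
end

section
/- (Barta-type inequality, Euclidean version.) Let E be a finite-dimensional real inner product space with Lebesgue (Haar) measure, Ω ⊆ E an open set, and let P : Ω → (E →L E) be a C¹ map such that P(x) is self-adjoint and positive definite for every x ∈ Ω. Let F : Ω → ℝ be measurable and bounded on compact subsets of Ω. Suppose u : Ω → ℝ is a positive C² function and c ∈ ℝ is such that −(div(P∇u)(x) − F(x)·u(x)) ≥ c·u(x) for every x ∈ Ω, where div(P∇u)(x) denotes the divergence at x of the vector field y ↦ P(y)(∇u(y)). Then for every smooth function φ : E → ℝ with compact support contained in Ω, ∫_Ω (⟨P(x)(∇φ(x)), ∇φ(x)⟩ + F(x)·φ(x)²) dx ≥ c · ∫_Ω φ(x)² dx. -/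
open scoped RealInnerProductSpace
open MeasureTheory

/-- The divergence of a vector field `X` at a point `x`: the trace of its Fréchet
derivative at `x`. -/
noncomputable def vdiv {E : Type*} [NormedAddCommGroup E] [NormedSpace ℝ E]
    (X : E → E) (x : E) : ℝ :=
  LinearMap.trace ℝ E ((fderiv ℝ X x) : E →ₗ[ℝ] E)

section Divergence

variable {E : Type*} [NormedAddCommGroup E] [InnerProductSpace ℝ E]

theorem hasCompactSupport_vdiv {X : E → E} (hX : HasCompactSupport X) :
    HasCompactSupport (vdiv X) :=
  (hX.fderiv ℝ).comp_left (g := fun L : E →L[ℝ] E => LinearMap.trace ℝ E (L : E →ₗ[ℝ] E))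
    (by simp)

variable [FiniteDimensional ℝ E]

theorem continuous_vdiv {X : E → E} (hX : ContDiff ℝ 1 X) : Continuous (vdiv X) := by
  have hdX : Continuous (fderiv ℝ X) := hX.continuous_fderiv one_ne_zero
  exact ((LinearMap.trace ℝ E ∘ₗ
    ContinuousLinearMap.coeLM ℝ).continuous_of_finiteDimensional).comp hdX

theorem vdiv_smul {f : E → ℝ} {X : E → E} {x : E} (hf : DifferentiableAt ℝ f x)
    (hX : DifferentiableAt ℝ X x) :
    vdiv (fun y => f y • X y) x = f x * vdiv X x + fderiv ℝ f x (X x) := by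
  rw [vdiv, vdiv, fderiv_fun_smul hf hX, ContinuousLinearMap.toLinearMap_add, map_add,
    ContinuousLinearMap.toLinearMap_smul, map_smul, smul_eq_mul]
  congr 1
  exact LinearMap.trace_smulRight _ _

variable [MeasurableSpace E] [BorelSpace E] (μ : Measure E) [μ.IsAddHaarMeasure]

theorem integral_fderiv_apply_eq_zero {G : Type*} [NormedAddCommGroup G] [NormedSpace ℝ G]
    {g : E → G} (hg : ContDiff ℝ 1 g) (hgc : HasCompactSupport g) (v : E) :
    ∫ x, fderiv ℝ g x v ∂μ = 0 := by
  have hg' : Integrable (fun x => fderiv ℝ g x v) μ :=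
    ((hg.continuous_fderiv one_ne_zero).clm_apply continuous_const).integrable_of_hasCompactSupport
      (hgc.fderiv_apply ℝ v)
  have h := integral_smul_fderiv_eq_neg_fderiv_smul_of_integrable (μ := μ)
    (f := fun _ : E => (1 : ℝ)) (g := g) (v := v) (by simp) (by simpa using hg')
    (by simpa using hg.continuous.integrable_of_hasCompactSupport hgc) (by simp)
    (fun x _ => hg.differentiable one_ne_zero x)
  simpa using h

theorem integral_vdiv_eq_zero {X : E → E} (hX : ContDiff ℝ 1 X) (hXc : HasCompactSupport X) :
    ∫ x, vdiv X x ∂μ = 0 := by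
  let L : (E →L[ℝ] E) → ℝ := fun T => LinearMap.trace ℝ E (T : E →ₗ[ℝ] E)
  have hint (v : E) : Integrable (fun x => fderiv ℝ X x v) μ :=
    ((hX.continuous_fderiv one_ne_zero).clm_apply continuous_const).integrable_of_hasCompactSupport
      (hXc.fderiv_apply ℝ v)
  simp only [vdiv, LinearMap.trace_eq_sum_inner _ (stdOrthonormalBasis ℝ E),
    ContinuousLinearMap.coe_coe]
  rw [integral_finsetSum _ fun i _ => (hint _).const_inner _]
  refine Finset.sum_eq_zero fun i _ => ?_
  rw [integral_inner (hint _), integral_fderiv_apply_eq_zero μ hX hXc, inner_zero_right]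

end Divergence

theorem ContDiffOn.contDiff_of_tsupport_subset {𝕜 E G : Type*} [NontriviallyNormedField 𝕜]
    [NormedAddCommGroup E] [NormedSpace 𝕜 E] [NormedAddCommGroup G] [NormedSpace 𝕜 G]
    {n : WithTop ℕ∞} {g : E → G} {s : Set E} (hg : ContDiffOn 𝕜 n g s) (hs : IsOpen s)
    (hsupp : tsupport g ⊆ s) : ContDiff 𝕜 n g := by
  refine contDiff_iff_contDiffAt.2 fun x => ?_
  by_cases hx : x ∈ s
  · exact hg.contDiffAt (hs.mem_nhds hx)
  · exact contDiffAt_const.congr_of_eventuallyEq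
      (notMem_tsupport_iff_eventuallyEq.1 fun h => hx (hsupp h))

theorem ContDiffOn.gradient_of_isOpen {E : Type*} [NormedAddCommGroup E] [InnerProductSpace ℝ E]
    [CompleteSpace E] {m n : WithTop ℕ∞} {f : E → ℝ} {s : Set E} (hf : ContDiffOn ℝ n f s)
    (hs : IsOpen s) (hmn : m + 1 ≤ n) : ContDiffOn ℝ m (gradient f) s :=
  (InnerProductSpace.toDual ℝ E).symm.contDiff.comp_contDiffOn (hf.fderiv_of_isOpen hs hmn)

/-- Completing the square for `T` at `a - r • b`. -/
theorem two_mul_inner_sub_sq_mul_inner_le {E : Type*} [NormedAddCommGroup E] [InnerProductSpace ℝ E]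
    {T : E →L[ℝ] E} (hT : ∀ a b : E, ⟪T a, b⟫ = ⟪a, T b⟫) (hT0 : ∀ a : E, 0 ≤ ⟪T a, a⟫)
    (a b : E) (r : ℝ) : 2 * r * ⟪a, T b⟫ - r ^ 2 * ⟪b, T b⟫ ≤ ⟪T a, a⟫ := by
  have h := hT0 (a - r • b)
  simp only [map_sub, map_smul, inner_sub_left, inner_sub_right, real_inner_smul_left,
    real_inner_smul_right, hT] at h
  have h1 : ⟪b, T a⟫ = ⟪a, T b⟫ := by rw [← hT, real_inner_comm]
  rw [h1] at h
  rw [hT]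
  linarith

theorem fderiv_sq_div_apply {E : Type*} [NormedAddCommGroup E] [NormedSpace ℝ E] {f g : E → ℝ}
    {x : E} (hf : DifferentiableAt ℝ f x) (hg : DifferentiableAt ℝ g x) (hx : g x ≠ 0) (v : E) :
    fderiv ℝ (fun y => f y ^ 2 / g y) x v =
      2 * (f x / g x) * fderiv ℝ f x v - (f x / g x) ^ 2 * fderiv ℝ g x v := by
  have h : HasFDerivAt (fun y => f y ^ 2 * (g y)⁻¹) _ x :=
    (hf.hasFDerivAt.pow 2).fun_mul ((hasDerivAt_inv hx).comp_hasFDerivAt x hg.hasFDerivAt)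
  simp only [div_eq_mul_inv]
  rw [h.fderiv]
  simp
  field_simp
  ring

/-- **Barta-type inequality, Euclidean version.** Let `Ω` be an open subset of a
finite-dimensional real inner product space equipped with a Haar (Lebesgue) measure, `P` a `C¹`
field of self-adjoint positive definite linear maps on `Ω`, `F` measurable and bounded on
compact subsets of `Ω`. If `u` is a positive `C²` function on `Ω` with
`−(div(P ∇u) x − F x · u x) ≥ c · u x` on `Ω`, then for every smooth `φ` compactly supported
in `Ω`, `∫_Ω (⟪P ∇φ, ∇φ⟫ + F φ²) ≥ c ∫_Ω φ²`. -/
theorem barta_inequality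
    {E : Type*} [NormedAddCommGroup E] [InnerProductSpace ℝ E] [FiniteDimensional ℝ E]
    [MeasurableSpace E] [BorelSpace E]
    (μ : Measure E) [μ.IsAddHaarMeasure]
    (Ω : Set E) (hΩ : IsOpen Ω)
    (P : E → E →L[ℝ] E) (hP : ContDiffOn ℝ 1 P Ω)
    (hP_selfadj : ∀ x ∈ Ω, ∀ a b : E, ⟪P x a, b⟫ = ⟪a, P x b⟫)
    (hP_pd : ∀ x ∈ Ω, ∀ a : E, a ≠ 0 → 0 < ⟪P x a, a⟫)
    (F : E → ℝ) (hF_meas : Measurable F)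
    (hF_loc : ∀ K : Set E, K ⊆ Ω → IsCompact K → ∃ M : ℝ, ∀ x ∈ K, |F x| ≤ M)
    (u : E → ℝ) (hu : ContDiffOn ℝ 2 u Ω) (hu_pos : ∀ x ∈ Ω, 0 < u x)
    (c : ℝ)
    (h_ineq : ∀ x ∈ Ω,
      c * u x ≤ -(vdiv (fun y => P y (gradient u y)) x - F x * u x))
    (φ : E → ℝ) (hφ : ContDiff ℝ (⊤ : ℕ∞) φ) (hφ_supp : HasCompactSupport φ)
    (hφΩ : tsupport φ ⊆ Ω) :
    c * ∫ x in Ω, (φ x) ^ 2 ∂μ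
      ≤ ∫ x in Ω, (⟪P x (gradient φ x), gradient φ x⟫ + F x * (φ x) ^ 2) ∂μ := by
  set W : E → E := fun y => P y (gradient u y)
  set X : E → E := fun y => (φ y ^ 2 / u y) • W y with hX
  have hW1 : ContDiffOn ℝ 1 W Ω := hP.clm_apply (hu.gradient_of_isOpen hΩ (by norm_num))
  have hf1 : ContDiffOn ℝ 1 (fun y => φ y ^ 2 / u y) Ω :=
    ((hφ.of_le (by simp)).contDiffOn.pow 2).div (hu.of_le (by norm_num))
      fun x hx => (hu_pos x hx).ne'
  have hφ0 {x : E} (hx : x ∉ tsupport φ) : φ x = 0 := image_eq_zero_of_notMem_tsupport hx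
  have hgrad0 {x : E} (hx : x ∉ tsupport φ) : gradient φ x = 0 := by
    have h : fderiv ℝ φ x = 0 :=
      image_eq_zero_of_notMem_tsupport fun h => hx (tsupport_fderiv_subset ℝ h)
    rw [gradient, h, map_zero]
  have hXsupp : tsupport X ⊆ tsupport φ :=
    closure_mono fun x hx h => hx (by simp [hX, h])
  have hX1 : ContDiff ℝ 1 X :=
    (hf1.smul hW1).contDiff_of_tsupport_subset hΩ (hXsupp.trans hφΩ)
  have hXc : HasCompactSupport X := hφ_supp.of_isClosed_subset (isClosed_tsupport X) hXsupp
  have hgrad : Continuous (gradient φ) :=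
    (InnerProductSpace.toDual ℝ E).symm.continuous.comp (hφ.continuous_fderiv (by simp))
  have hsq : Integrable (fun x => φ x ^ 2) μ :=
    have hc : Continuous (fun x => φ x ^ 2) := hφ.continuous.pow 2
    hc.integrable_of_hasCompactSupport
      (hφ_supp.comp_left (g := fun t : ℝ => t ^ 2) (by simp))
  have hPint : Integrable (fun x => ⟪P x (gradient φ x), gradient φ x⟫) μ := by
    have hc : ContinuousOn (fun x => ⟪P x (gradient φ x), gradient φ x⟫) (tsupport φ) :=
      ((hP.continuousOn.mono hφΩ).clm_apply hgrad.continuousOn).inner hgrad.continuousOn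
    exact (hc.integrableOn_compact hφ_supp).integrable_of_forall_notMem_eq_zero
      fun x hx => by rw [hgrad0 hx, inner_zero_right]
  have hFint : Integrable (fun x => F x * φ x ^ 2) μ := by
    obtain ⟨M, hM⟩ := hF_loc _ hφΩ hφ_supp
    have h : IntegrableOn (fun x => F x * φ x ^ 2) (tsupport φ) μ :=
      hsq.integrableOn.bdd_mul (c := M) hF_meas.aestronglyMeasurable
        ((ae_restrict_iff' (isClosed_tsupport φ).measurableSet).2 (.of_forall hM))
    exact h.integrable_of_forall_notMem_eq_zero fun x hx => by simp [hφ0 hx]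
  have hdivint : Integrable (vdiv X) μ :=
    (continuous_vdiv hX1).integrable_of_hasCompactSupport (hasCompactSupport_vdiv hXc)
  rw [setIntegral_eq_integral_of_forall_compl_eq_zero
      fun x hx => by simp [hφ0 fun h => hx (hφΩ h)],
    setIntegral_eq_integral_of_forall_compl_eq_zero
      fun x hx => by simp [hφ0 fun h => hx (hφΩ h), hgrad0 fun h => hx (hφΩ h)],
    ← integral_const_mul, ← add_zero (∫ x, c * φ x ^ 2 ∂μ), ← integral_vdiv_eq_zero μ hX1 hXc,
    ← integral_add (hsq.const_mul c) hdivint]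
  have hlhs : Integrable (fun x => c * φ x ^ 2 + vdiv X x) μ := (hsq.const_mul c).add hdivint
  have hrhs : Integrable (fun x => ⟪P x (gradient φ x), gradient φ x⟫ + F x * φ x ^ 2) μ :=
    hPint.add hFint
  refine integral_mono hlhs hrhs fun x => ?_
  by_cases hx : x ∈ Ω
  · have hxΩ : Ω ∈ nhds x := hΩ.mem_nhds hx
    have hux := hu_pos x hx
    have hdiv : vdiv X x = φ x ^ 2 / u x * vdiv W x +
        (2 * (φ x / u x) * ⟪gradient φ x, W x⟫ - (φ x / u x) ^ 2 * ⟪gradient u x, W x⟫) := by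
      rw [hX, vdiv_smul ((hf1.contDiffAt hxΩ).differentiableAt one_ne_zero)
        ((hW1.contDiffAt hxΩ).differentiableAt one_ne_zero),
        fderiv_sq_div_apply (hφ.differentiable (by simp) x)
          ((hu.contDiffAt hxΩ).differentiableAt two_ne_zero) hux.ne',
        inner_gradient_left, inner_gradient_left]
    have hsquare := two_mul_inner_sub_sq_mul_inner_le (hP_selfadj x hx)
      (fun a => by
        rcases eq_or_ne a 0 with rfl | ha
        · simp
        · exact (hP_pd x hx a ha).le) (gradient φ x) (gradient u x) (φ x / u x)
    have hsuper : φ x ^ 2 / u x * (c * u x) ≤ φ x ^ 2 / u x * -(vdiv W x - F x * u x) :=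
      mul_le_mul_of_nonneg_left (h_ineq x hx) (by positivity)
    have hcancel : φ x ^ 2 / u x * u x = φ x ^ 2 := div_mul_cancel₀ _ hux.ne'
    have hl : φ x ^ 2 / u x * (c * u x) = c * φ x ^ 2 := by rw [← hcancel]; field_simp
    have hr : φ x ^ 2 / u x * -(vdiv W x - F x * u x) =
        F x * φ x ^ 2 - φ x ^ 2 / u x * vdiv W x := by linear_combination F x * hcancel
    change c * φ x ^ 2 + vdiv X x ≤ ⟪P x (gradient φ x), gradient φ x⟫ + F x * φ x ^ 2
    rw [hdiv]
    linarith
  · have hxφ : x ∉ tsupport φ := fun h => hx (hφΩ h)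
    have hdX : fderiv ℝ X x = 0 :=
      image_eq_zero_of_notMem_tsupport fun h => hxφ (hXsupp (tsupport_fderiv_subset ℝ h))
    simp [vdiv, hdX, hφ0 hxφ, hgrad0 hxφ]
end

section
/- Let E be a real inner product space of finite dimension m ≥ 1 and let A : E → E be a self-adjoint linear map with trace(A) = 0. Then every eigenvalue λ of A satisfies λ² ≤ ((m−1)/m) · trace(A²), where A² = A ∘ A. -/
open scoped RealInnerProductSpace

/-- In a vanishing finite sum of reals, the square of any term is controlled by the sum of all
squares. -/
theorem card_mul_sq_le_of_sum_eq_zero {ι : Type*} [Fintype ι] (f : ι → ℝ)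
    (hf : ∑ i, f i = 0) (i : ι) :
    (Fintype.card ι : ℝ) * f i ^ 2 ≤ ((Fintype.card ι : ℝ) - 1) * ∑ j, f j ^ 2 := by
  classical
  have hcs := sq_sum_le_card_mul_sum_sq (s := Finset.univ.erase i) (f := f)
  have hcard : ((Finset.univ.erase i).card : ℝ) = (Fintype.card ι : ℝ) - 1 := by
    rw [Finset.cast_card_erase_of_mem (Finset.mem_univ i), Finset.card_univ]
  have hsum := Finset.add_sum_erase Finset.univ f (Finset.mem_univ i)
  have hsq := Finset.add_sum_erase Finset.univ (fun j => f j ^ 2) (Finset.mem_univ i)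
  have hrest : ∑ j ∈ Finset.univ.erase i, f j = -f i := by linarith
  rw [hcard, hrest] at hcs
  rw [← hsq]
  linarith

/-- The trace of the square of a symmetric map is the sum of its squared eigenvalues. -/
theorem LinearMap.IsSymmetric.trace_comp_self_eq_sum_eigenvalues_sq
    {E : Type*} [NormedAddCommGroup E] [InnerProductSpace ℝ E] [FiniteDimensional ℝ E]
    {m : ℕ} (hm : Module.finrank ℝ E = m) {A : E →ₗ[ℝ] E} (hA : A.IsSymmetric) :
    LinearMap.trace ℝ E (A ∘ₗ A) = ∑ i, hA.eigenvalues hm i ^ 2 := by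
  rw [LinearMap.trace_eq_sum_inner _ (hA.eigenvectorBasis hm)]
  refine Finset.sum_congr rfl fun i _ => ?_
  simp [hA.apply_eigenvectorBasis hm, inner_smul_right, pow_two]

/-- Every eigenvalue of a symmetric map occurs in its list of eigenvalues. -/
theorem LinearMap.IsSymmetric.exists_eigenvalues_eq_of_apply_eq_smul
    {E : Type*} [NormedAddCommGroup E] [InnerProductSpace ℝ E] [FiniteDimensional ℝ E]
    {m : ℕ} (hm : Module.finrank ℝ E = m) {A : E →ₗ[ℝ] E} (hA : A.IsSymmetric)
    {lam : ℝ} {X : E} (hX : X ≠ 0) (heig : A X = lam • X) :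
    ∃ i, hA.eigenvalues hm i = lam := by
  by_contra! hne
  refine hX (InnerProductSpace.ext_inner_left_basis (𝕜 := ℝ) (hA.eigenvectorBasis hm).toBasis fun i => ?_)
  have h := hA (hA.eigenvectorBasis hm i) X
  rw [hA.apply_eigenvectorBasis hm, heig, inner_smul_left, inner_smul_right] at h
  simpa using (mul_eq_mul_right_iff.mp h).resolve_left (hne i)

/-- If `A` is a self-adjoint, trace-free linear map on a real inner product space of finite
dimension `m ≥ 1`, then every eigenvalue `λ` of `A` satisfies
`λ² ≤ ((m − 1)/m) · trace(A²)`. -/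
theorem eigenvalue_sq_le_of_traceless
    {E : Type*} [NormedAddCommGroup E] [InnerProductSpace ℝ E] [FiniteDimensional ℝ E]
    (m : ℕ) (hm : Module.finrank ℝ E = m) (hm1 : 1 ≤ m)
    (A : E →ₗ[ℝ] E) (hA : ∀ a b : E, ⟪A a, b⟫ = ⟪a, A b⟫)
    (htr : LinearMap.trace ℝ E A = 0)
    (lam : ℝ) (X : E) (hX : X ≠ 0) (heig : A X = lam • X) :
    lam ^ 2 ≤ ((m : ℝ) - 1) / m * LinearMap.trace ℝ E (A ∘ₗ A) := by
  have hS : A.IsSymmetric := hA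
  obtain ⟨i, rfl⟩ := hS.exists_eigenvalues_eq_of_apply_eq_smul hm hX heig
  have hsum : ∑ j, hS.eigenvalues hm j = 0 := by
    rw [← htr, hS.trace_eq_sum_eigenvalues hm]
    simp
  have key := card_mul_sq_le_of_sum_eq_zero (hS.eigenvalues hm) hsum i
  rw [Fintype.card_fin] at key
  have hpos : (0 : ℝ) < m := by exact_mod_cast hm1
  rw [hS.trace_comp_self_eq_sum_eigenvalues_sq hm, div_mul_eq_mul_div, le_div_iff₀ hpos]
  linarith
end

section
/- (Refined Kato-type inequality.) Let E be a real inner product space of finite dimension m ≥ 1 and let A : E → E be a self-adjoint linear map with trace(A) = 0. Then for every X ∈ E, ‖A X‖² ≤ ((m−1)/m) · trace(A²) · ‖X‖², where A² = A ∘ A. -/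
open scoped RealInnerProductSpace

/-- If finitely many real numbers sum to zero, the square of each is at most `(n - 1) / n` times
the sum of all squares. -/
lemma sq_le_mul_sum_sq_of_sum_eq_zero {ι : Type*} [Fintype ι] (f : ι → ℝ) (hf : ∑ j, f j = 0)
    (i : ι) :
    f i ^ 2 ≤ ((Fintype.card ι : ℝ) - 1) / Fintype.card ι * ∑ j, f j ^ 2 := by
  classical
  have hpos : 0 < Fintype.card ι := Fintype.card_pos_iff.mpr ⟨i⟩
  have hcard : ((Finset.univ.erase i).card : ℝ) = (Fintype.card ι : ℝ) - 1 := by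
    rw [Finset.card_erase_of_mem (Finset.mem_univ i), Finset.card_univ, Nat.cast_pred hpos]
  have hcs := sq_sum_le_card_mul_sum_sq (s := Finset.univ.erase i) (f := f)
  have hsum := Finset.add_sum_erase Finset.univ f (Finset.mem_univ i)
  have hsq := Finset.add_sum_erase Finset.univ (fun j => f j ^ 2) (Finset.mem_univ i)
  rw [hcard, show ∑ j ∈ Finset.univ.erase i, f j = -f i by linarith,
    show ∑ j ∈ Finset.univ.erase i, f j ^ 2 = (∑ j, f j ^ 2) - f i ^ 2 by linarith] at hcs
  rw [div_mul_eq_mul_div, le_div_iff₀ (by exact_mod_cast hpos)]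
  linarith

/-- **Refined Kato-type inequality.** If `A` is a self-adjoint, trace-free linear map on a real
inner product space of finite dimension `m ≥ 1`, then for every vector `X`,
`‖A X‖² ≤ ((m − 1)/m) · trace(A²) · ‖X‖²`. -/
theorem refined_kato_inequality
    {E : Type*} [NormedAddCommGroup E] [InnerProductSpace ℝ E] [FiniteDimensional ℝ E]
    (m : ℕ) (hm : Module.finrank ℝ E = m) (hm1 : 1 ≤ m)
    (A : E →ₗ[ℝ] E) (hA : ∀ a b : E, ⟪A a, b⟫ = ⟪a, A b⟫)
    (htr : LinearMap.trace ℝ E A = 0) (X : E) :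
    ‖A X‖ ^ 2 ≤ ((m : ℝ) - 1) / m * LinearMap.trace ℝ E (A ∘ₗ A) * ‖X‖ ^ 2 := by
  have hS : A.IsSymmetric := hA
  let b := hS.eigenvectorBasis hm
  have hb (i : Fin m) : A (b i) = hS.eigenvalues hm i • b i := hS.apply_eigenvectorBasis hm i
  have hsum : ∑ i, hS.eigenvalues hm i = 0 := by
    rw [← htr]
    exact (hS.trace_eq_sum_eigenvalues hm).symm
  have htr2 : LinearMap.trace ℝ E (A ∘ₗ A) = ∑ i, hS.eigenvalues hm i ^ 2 := by
    rw [LinearMap.trace_eq_sum_inner _ b]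
    refine Finset.sum_congr rfl fun i _ => ?_
    rw [LinearMap.comp_apply, ← hA, hb, real_inner_self_eq_norm_sq, norm_smul, b.norm_eq_one]
    simp
  rw [htr2, ← b.sum_sq_norm_inner_right (A X), ← b.sum_sq_norm_inner_right X, Finset.mul_sum]
  refine Finset.sum_le_sum fun i _ => ?_
  rw [← hA, hb, real_inner_smul_left, norm_mul, mul_pow, Real.norm_eq_abs, sq_abs]
  gcongr
  simpa using sq_le_mul_sum_sq_of_sum_eq_zero _ hsum i
end

section
/- Let I₀ ⊆ ℝ be a nonempty open interval and let ρ : I₀ → ℝ be a positive twice differentiable function. If there exists a constant C ∈ ℝ such that ρ(t)·ρ''(t) − ρ'(t)² = C for all t ∈ I₀, then the function t ↦ ρ''(t)/ρ(t) is constant on I₀. -/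
/-- Let `I₀ ⊆ ℝ` be a nonempty open interval and `ρ : I₀ → ℝ` a positive twice differentiable
function. If `ρ·ρ'' − (ρ')² ≡ C` on `I₀` for some constant `C`, then `ρ''/ρ` is constant
on `I₀`. -/
theorem secondDeriv_div_self_const_of_wronskian_const
    (I₀ : Set ℝ) (hI_open : IsOpen I₀) (hI_ne : I₀.Nonempty) (hI_oc : I₀.OrdConnected)
    (ρ : ℝ → ℝ) (hρ_pos : ∀ t ∈ I₀, 0 < ρ t)
    (hρ_diff : ∀ t ∈ I₀, DifferentiableAt ℝ ρ t)
    (hρ_diff2 : ∀ t ∈ I₀, DifferentiableAt ℝ (deriv ρ) t)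
    (C : ℝ)
    (hC : ∀ t ∈ I₀, ρ t * deriv (deriv ρ) t - (deriv ρ t) ^ 2 = C) :
    ∃ K : ℝ, ∀ t ∈ I₀, deriv (deriv ρ) t / ρ t = K := by
  have h_quot : ∀ t ∈ I₀, deriv (deriv ρ) t / ρ t = (C + deriv ρ t ^ 2) / ρ t ^ 2 := by
    intro t ht
    have h_ne := (hρ_pos t ht).ne'
    rw [← hC t ht]
    field_simp
    ring
  have h_deriv : ∀ t ∈ I₀, HasDerivAt (fun s => (C + deriv ρ s ^ 2) / ρ s ^ 2) 0 t := by
    intro t ht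
    have h_ne := (hρ_pos t ht).ne'
    have h_num := ((hρ_diff2 t ht).hasDerivAt.pow 2).const_add C
    have h_den := (hρ_diff t ht).hasDerivAt.pow 2
    refine (h_num.div h_den (pow_ne_zero 2 h_ne)).congr_deriv ?_
    rw [div_eq_zero_iff]
    left
    simp only [Pi.pow_apply]
    push_cast
    linear_combination (2 * ρ t * deriv ρ t) * hC t ht
  obtain ⟨K, hK⟩ := hI_open.exists_is_const_of_deriv_eq_zero hI_oc.isPreconnected
    (fun t ht => (h_deriv t ht).differentiableAt.differentiableWithinAt)
    (fun t ht => (h_deriv t ht).deriv)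
  exact ⟨K, fun t ht => (h_quot t ht).trans (hK t ht)⟩
end

section
/- Let A be a real symmetric m × m matrix with eigenvalues κ₁, …, κ_m (listed with multiplicity). For 1 ≤ k ≤ m set S_k equal to the k-th elementary symmetric polynomial of κ₁, …, κ_m and H_k = (−1)^k S_k / binom(m,k), with H₀ = 1; define the Newton matrices by P₀ = I and P_k = binom(m,k)·H_k·I + A·P_{k−1} for 1 ≤ k ≤ m. Then for every 1 ≤ k ≤ m−2 and every real number κ̄: κ̄·trace(P_k) − trace(A²·P_k) = binom(m,k)·(m−k)·κ̄·H_k + binom(m,k+1)·((m−k−1)·H_{k+2} − m·H₁·H_{k+1}). -/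
open Finset

/-- The power sums of the roots of the characteristic polynomial of a real symmetric matrix are the
traces of its powers. -/
theorem Matrix.IsSymm.trace_pow_eq_sum_pow {n : Type*} [Fintype n] [DecidableEq n]
    {A : Matrix n n ℝ} (hA : A.IsSymm) {κ : n → ℝ}
    (hκ : A.charpoly = ∏ i, (Polynomial.X - Polynomial.C (κ i))) (j : ℕ) :
    (A ^ j).trace = ∑ i, κ i ^ j := by
  have hH : A.IsHermitian := by
    rw [Matrix.IsHermitian, Matrix.conjTranspose_eq_transpose_of_trivial]
    exact hA
  have hroots : Multiset.map κ univ.val = Multiset.map hH.eigenvalues univ.val := by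
    have h := hH.roots_charpoly_eq_eigenvalues
    rw [hκ, Polynomial.roots_prod _ _ (prod_ne_zero_iff.mpr fun i _ =>
      Polynomial.X_sub_C_ne_zero (κ i))] at h
    simpa using h
  have htrace : (A ^ j).trace = ∑ i, hH.eigenvalues i ^ j := by
    conv_lhs => rw [hH.spectral_theorem]
    rw [← map_pow, Matrix.diagonal_pow, Unitary.conjStarAlgAut_apply, Matrix.trace_mul_cycle]
    simp [Matrix.trace]
  rw [htrace]
  have h := congrArg (fun s : Multiset ℝ => (s.map (· ^ j)).sum) hroots
  simp only [Multiset.map_map] at h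
  exact h.symm

/-- Newton's identities, for the signed elementary symmetric polynomials of a finite family. -/
theorem sum_range_signed_esymm_mul_psum {n R : Type*} [Fintype n] [CommRing R] (κ : n → R)
    (k : ℕ) :
    ∑ i ∈ range k, ((-1) ^ i * ∑ s ∈ univ.powersetCard i, ∏ a ∈ s, κ a) * ∑ a, κ a ^ (k - i) =
      -(k * ((-1) ^ k * ∑ s ∈ univ.powersetCard k, ∏ a ∈ s, κ a)) := by
  have h := congrArg (MvPolynomial.aeval κ) (MvPolynomial.mul_esymm_eq_sum n R k)
  rw [sum_filter, Nat.sum_antidiagonal_eq_sum_range_succ_mk, sum_range_succ] at h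
  simp only [lt_irrefl, if_false, add_zero] at h
  rw [sum_congr rfl fun i hi => if_pos (mem_range.mp hi)] at h
  simp only [MvPolynomial.esymm, MvPolynomial.psum, map_mul, map_sum, map_prod, map_pow, map_neg,
    map_one, map_natCast, MvPolynomial.aeval_X] at h
  rw [mul_left_comm, h, ← mul_assoc, ← pow_add, ← add_assoc, pow_succ, ← two_mul, pow_mul]
  simp

/-- Traces of a Horner-type sequence of matrices times powers of the base matrix. -/
theorem Matrix.trace_pow_mul_horner {n R : Type*} [Fintype n] [DecidableEq n] [CommRing R]
    {A : Matrix n n R} {c : ℕ → R} {P : ℕ → Matrix n n R} {N : ℕ} (hP0 : P 0 = c 0 • 1)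
    (hP : ∀ k < N, P (k + 1) = c (k + 1) • 1 + A * P k) {k : ℕ} (hk : k ≤ N) (j : ℕ) :
    (A ^ j * P k).trace = ∑ i ∈ range (k + 1), c i * (A ^ (j + k - i)).trace := by
  induction k generalizing j with
  | zero => simp [hP0]
  | succ k ih =>
    rw [hP k hk, mul_add, Matrix.trace_add, ← mul_assoc, ← pow_succ, ih (by lia), add_comm,
      sum_range_succ _ (k + 1)]
    simp [add_assoc, add_comm 1 k]

/-- Let `A` be a real symmetric `m × m` matrix (`m ≥ 3`) with eigenvalues `κ₁, …, κ_m` listed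
with multiplicity (i.e. the characteristic polynomial of `A` splits as `∏ (X − κᵢ)`). With
`S_k` the `k`-th elementary symmetric polynomial of the eigenvalues,
`H_k = (−1)^k S_k / binom(m,k)` (and `H₀ = 1`), and Newton matrices `P₀ = I`,
`P_k = binom(m,k)·H_k·I + A·P_{k−1}`, one has, for `1 ≤ k ≤ m − 2` and any `κ̄ ∈ ℝ`:
`κ̄·tr(P_k) − tr(A²·P_k)
  = binom(m,k)·(m−k)·κ̄·H_k + binom(m,k+1)·((m−k−1)·H_{k+2} − m·H₁·H_{k+1})`. -/
theorem newton_tensor_trace_identity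
    (m : ℕ) (hm : 3 ≤ m)
    (A : Matrix (Fin m) (Fin m) ℝ) (hA : A.IsSymm)
    (κ : Fin m → ℝ)
    (hκ : A.charpoly = ∏ i : Fin m, (Polynomial.X - Polynomial.C (κ i)))
    (S : ℕ → ℝ)
    (hS : ∀ k, S k = ∑ s ∈ Finset.univ.powersetCard k, ∏ i ∈ s, κ i)
    (H : ℕ → ℝ) (hH0 : H 0 = 1)
    (hH : ∀ k, 1 ≤ k → k ≤ m → H k = (-1 : ℝ) ^ k * S k / (m.choose k))
    (P : ℕ → Matrix (Fin m) (Fin m) ℝ) (hP0 : P 0 = 1)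
    (hP : ∀ k, 1 ≤ k → k ≤ m →
      P k = ((m.choose k : ℝ) * H k) • (1 : Matrix (Fin m) (Fin m) ℝ) + A * P (k - 1))
    (k : ℕ) (hk1 : 1 ≤ k) (hk2 : k ≤ m - 2) (κbar : ℝ) :
    κbar * (P k).trace - (A * A * P k).trace
      = (m.choose k : ℝ) * ((m : ℝ) - k) * κbar * H k
        + (m.choose (k + 1) : ℝ) * (((m : ℝ) - k - 1) * H (k + 2) - m * H 1 * H (k + 1)) := by
  have hc : ∀ i ≤ m, (m.choose i : ℝ) * H i = (-1) ^ i * S i := by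
    intro i hi
    have hpos : (m.choose i : ℝ) ≠ 0 := by exact_mod_cast (Nat.choose_pos hi).ne'
    rcases Nat.eq_zero_or_pos i with rfl | h0
    · simp [hH0, hS]
    · rw [hH i h0 hi]
      field_simp
  have hnewton : ∀ l, ∑ i ∈ range l, ((-1) ^ i * S i) * (A ^ (l - i)).trace =
      -(l * ((-1) ^ l * S l)) := by
    intro l
    simp only [hA.trace_pow_eq_sum_pow hκ, hS]
    exact sum_range_signed_esymm_mul_psum κ l
  have htr : ∀ j, (A ^ j * P k).trace =
      ∑ i ∈ range (k + 1), ((-1) ^ i * S i) * (A ^ (j + k - i)).trace := by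
    refine Matrix.trace_pow_mul_horner (N := m) (by simp [hP0, hS]) (fun l hl => ?_) (by lia)
    rw [hP (l + 1) (by lia) hl, hc _ hl, Nat.add_sub_cancel]
  have htr0 : (P k).trace = (m - k) * ((-1) ^ k * S k) := by
    have h := htr 0
    rw [sum_range_succ] at h
    simp only [pow_zero, one_mul, zero_add, hnewton, Nat.sub_self, Matrix.trace_one,
      Fintype.card_fin] at h
    rw [h]
    ring
  have htrA : A.trace = S 1 := by
    have hS0 : S 0 = 1 := by simp [hS]
    simpa [hS0] using hnewton 1
  have htr2 : (A * A * P k).trace =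
      -((k + 2) * ((-1) ^ (k + 2) * S (k + 2))) - (-1) ^ (k + 1) * S (k + 1) * S 1 := by
    have h := hnewton (k + 2)
    rw [sum_range_succ, show k + 2 - (k + 1) = 1 by lia, pow_one, htrA] at h
    rw [← pow_two, htr 2, add_comm 2 k]
    push_cast at h
    linarith
  have h1 : (m : ℝ) * H 1 = -S 1 := by simpa using hc 1 (by lia)
  have hchoose : (m.choose (k + 1) : ℝ) * (m - k - 1) = m.choose (k + 2) * (k + 2) := by
    have h := congrArg (Nat.cast (R := ℝ)) (Nat.choose_succ_right_eq m (k + 1))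
    rw [Nat.cast_mul, Nat.cast_mul, Nat.cast_sub (by lia)] at h
    push_cast at h
    linarith
  have hk := hc k (by lia)
  have hk1' := hc (k + 1) (by lia)
  have hk2' := hc (k + 2) (by lia)
  rw [htr0, htr2, ← hk, ← hk1', ← hk2']
  linear_combination (-H (k + 2)) * hchoose + m.choose (k + 1) * H (k + 1) * h1
end
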